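/- Let T be a tree of order n(T) ≥ 3, not isomorphic to the path P_4, with γ_t^{oi}(S(T)) = (4n(T) − l(T) − s(T))/3, let v_1 v_2 ⋯ v_{d+1} be a diametral path in T (a path of length equal to the diameter d of T), and suppose both v_2 and v_3 have degree 2 in T. Then, in the tree T' = T − {v_1, v_2, v_3}, the vertex v_4 is a weak leaf, and T' satisfies γ_t^{oi}(S(T')) = (4n(T') − l(T') − s(T'))/3. -/

import Mathlib

open SimpleGraph

universe u

/-- A total outer-independent dominating set: every vertex has a neighbor in `D`,
and the complement of `D` is an independent set. -/
def IsTOIDS {V : Type u} (G : SimpleGraph V) (D : Set V) : Prop :=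
  (∀ v : V, ∃ u ∈ D, G.Adj v u) ∧ ∀ u ∉ D, ∀ w ∉ D, ¬ G.Adj u w

/-- The total outer-independent domination number. -/
noncomputable def toidNumber {V : Type u} (G : SimpleGraph V) : ℕ :=
  sInf {n : ℕ | ∃ D : Set V, IsTOIDS G D ∧ D.ncard = n}

/-- The subdivision graph: each edge is replaced by a new vertex adjacent exactly to
its two endpoints. -/
def subdivision {V : Type u} (G : SimpleGraph V) : SimpleGraph (V ⊕ G.edgeSet) :=
  SimpleGraph.fromRel fun x y =>
    ∃ (v : V) (e : G.edgeSet), x = Sum.inl v ∧ y = Sum.inr e ∧ v ∈ (e : Sym2 V)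

/-- A leaf: a vertex with exactly one neighbor. -/
def IsLeafVert {V : Type u} (G : SimpleGraph V) (v : V) : Prop := ∃! u, G.Adj v u

/-- A support vertex: a vertex adjacent to a leaf. -/
def IsSupportVert {V : Type u} (G : SimpleGraph V) (v : V) : Prop :=
  ∃ u, G.Adj v u ∧ IsLeafVert G u

/-- A strong support vertex: a vertex adjacent to at least two leaves. -/
def IsStrongSupportVert {V : Type u} (G : SimpleGraph V) (v : V) : Prop :=
  ∃ u w, u ≠ w ∧ G.Adj v u ∧ G.Adj v w ∧ IsLeafVert G u ∧ IsLeafVert G w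

/-- A strong leaf: a leaf adjacent to a strong support vertex. -/
def IsStrongLeaf {V : Type u} (G : SimpleGraph V) (v : V) : Prop :=
  IsLeafVert G v ∧ ∃ u, G.Adj v u ∧ IsStrongSupportVert G u

/-- A weak leaf: a leaf that is not a strong leaf. -/
def IsWeakLeaf {V : Type u} (G : SimpleGraph V) (v : V) : Prop :=
  IsLeafVert G v ∧ ¬ IsStrongLeaf G v

/-- A semi-support vertex: neither a leaf nor a support vertex, but adjacent to a
support vertex. -/
def IsSemiSupportVert {V : Type u} (G : SimpleGraph V) (v : V) : Prop :=
  ¬ IsLeafVert G v ∧ ¬ IsSupportVert G v ∧ ∃ u, G.Adj v u ∧ IsSupportVert G u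

/-- The number of leaves, with the convention that `P₂` has exactly one leaf. -/
noncomputable def leafCount {V : Type u} (G : SimpleGraph V) : ℕ :=
  if Nat.card V = 2 then 1 else {v | IsLeafVert G v}.ncard

/-- The number of support vertices, with the convention that `P₂` has exactly one
support vertex. -/
noncomputable def supportCount {V : Type u} (G : SimpleGraph V) : ℕ :=
  if Nat.card V = 2 then 1 else {v | IsSupportVert G v}.ncard

/-- The graph obtained from `G` by attaching a path `P_r` to the vertex `v`:
the new vertices form a path `p₀ p₁ ⋯ p_{r-1}` and `v` is joined to the end `p₀`. -/
def attachPath {V : Type u} (G : SimpleGraph V) (v : V) (r : ℕ) :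
    SimpleGraph (V ⊕ Fin r) :=
  SimpleGraph.fromRel fun x y =>
    (∃ a b, x = Sum.inl a ∧ y = Sum.inl b ∧ G.Adj a b) ∨
    (∃ i j : Fin r, x = Sum.inr i ∧ y = Sum.inr j ∧ (j : ℕ) = (i : ℕ) + 1) ∨
    (∃ i : Fin r, x = Sum.inl v ∧ y = Sum.inr i ∧ (i : ℕ) = 0)

/-- The graph obtained from `G` by adding a disjoint copy of the tree `Q_r`
(`r` paths `P₃` joined to a central vertex) and identifying the central vertex
of `Q_r` with the vertex `v` of `G`. -/
def attachQ {V : Type u} (G : SimpleGraph V) (v : V) (r : ℕ) :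
    SimpleGraph (V ⊕ Fin r × Fin 3) :=
  SimpleGraph.fromRel fun x y =>
    (∃ a b, x = Sum.inl a ∧ y = Sum.inl b ∧ G.Adj a b) ∨
    (∃ i : Fin r, x = Sum.inl v ∧ y = Sum.inr (i, 0)) ∨
    (∃ (i : Fin r) (j k : Fin 3),
      x = Sum.inr (i, j) ∧ y = Sum.inr (i, k) ∧ (k : ℕ) = (j : ℕ) + 1)

/-- The family `F`: all trees obtainable from `P₂` by repeatedly
(F1) attaching `P₁` to a support vertex, (F2) attaching `P₂` to a support or
semi-support vertex, (F3) attaching `P₃` to a weak leaf. -/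
inductive InFamilyF : {W : Type u} → SimpleGraph W → Prop
  | base {W : Type u} (G : SimpleGraph W) (e : G ≃g SimpleGraph.pathGraph 2) :
      InFamilyF G
  | op1 {W : Type u} {G' : SimpleGraph W} {v : W} (hv : IsSupportVert G' v)
      (hF : InFamilyF G') {U : Type u} (G : SimpleGraph U)
      (e : G ≃g attachPath G' v 1) : InFamilyF G
  | op2 {W : Type u} {G' : SimpleGraph W} {v : W}
      (hv : IsSupportVert G' v ∨ IsSemiSupportVert G' v)
      (hF : InFamilyF G') {U : Type u} (G : SimpleGraph U)
      (e : G ≃g attachPath G' v 2) : InFamilyF G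
  | op3 {W : Type u} {G' : SimpleGraph W} {v : W} (hv : IsWeakLeaf G' v)
      (hF : InFamilyF G') {U : Type u} (G : SimpleGraph U)
      (e : G ≃g attachPath G' v 3) : InFamilyF G

/-- The family `𝒯`: all trees obtainable from `P₂` by repeatedly
(O1) attaching `P₁` to a support vertex, (O2) attaching `P₃` to a support vertex or a
weak leaf, (O3) adding a copy of `Q_r` (`r ≥ 2`) identifying its central vertex with a
weak leaf. -/
inductive InFamilyT : {W : Type u} → SimpleGraph W → Prop
  | base {W : Type u} (G : SimpleGraph W) (e : G ≃g SimpleGraph.pathGraph 2) :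
      InFamilyT G
  | op1 {W : Type u} {G' : SimpleGraph W} {v : W} (hv : IsSupportVert G' v)
      (hF : InFamilyT G') {U : Type u} (G : SimpleGraph U)
      (e : G ≃g attachPath G' v 1) : InFamilyT G
  | op2 {W : Type u} {G' : SimpleGraph W} {v : W}
      (hv : IsSupportVert G' v ∨ IsWeakLeaf G' v)
      (hF : InFamilyT G') {U : Type u} (G : SimpleGraph U)
      (e : G ≃g attachPath G' v 3) : InFamilyT G
  | op3 {W : Type u} {G' : SimpleGraph W} {v : W} (hv : IsWeakLeaf G' v)
      (hF : InFamilyT G') {r : ℕ} (hr : 2 ≤ r) {U : Type u} (G : SimpleGraph U)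
      (e : G ≃g attachQ G' v r) : InFamilyT G

/-- Encoding of a total outer-independent dominating set of the subdivision graph of `G`:
`A` collects its original vertices and `F` the edges whose subdivision vertices it contains. -/
structure IsMixedCover {V : Type u} (G : SimpleGraph V) (A : Finset V)
    (F : Finset (Sym2 V)) : Prop where
  adj : ∀ {u v}, s(u, v) ∈ F → G.Adj u v
  cover : ∀ v, ∃ u, s(v, u) ∈ F
  left_or_right : ∀ {u v}, G.Adj u v → u ∈ A ∨ v ∈ A
  mem_of_notMem : ∀ {u v}, G.Adj u v → u ∉ A → s(u, v) ∈ F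

section Subdivision

variable {V : Type u} {G : SimpleGraph V}

lemma subdivision_adj_inl_inr {v : V} {e : G.edgeSet} :
    (subdivision G).Adj (Sum.inl v) (Sum.inr e) ↔ v ∈ (e : Sym2 V) := by
  simp [subdivision]

lemma subdivision_adj_inr_inl {v : V} {e : G.edgeSet} :
    (subdivision G).Adj (Sum.inr e) (Sum.inl v) ↔ v ∈ (e : Sym2 V) := by
  rw [SimpleGraph.adj_comm, subdivision_adj_inl_inr]

lemma not_subdivision_adj_inl_inl {u v : V} :
    ¬ (subdivision G).Adj (Sum.inl u) (Sum.inl v) := by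
  simp [subdivision]

lemma not_subdivision_adj_inr_inr {e f : G.edgeSet} :
    ¬ (subdivision G).Adj (Sum.inr e) (Sum.inr f) := by
  simp [subdivision]

lemma IsTOIDS.exists_isMixedCover [Fintype V] {D : Set (V ⊕ G.edgeSet)}
    (hD : IsTOIDS (subdivision G) D) :
    ∃ A F, IsMixedCover G A F ∧ A.card + F.card = D.ncard := by
  classical
  obtain ⟨h1, h2⟩ := hD
  have key : ∀ {u v : V} (h : s(u, v) ∈ G.edgeSet), u ∉ {v | Sum.inl v ∈ D} →
      Sum.inr ⟨s(u, v), h⟩ ∈ D := by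
    intro u v h hu
    by_contra hc
    exact h2 _ hu _ hc (subdivision_adj_inl_inr.2 (by simp))
  refine ⟨(Set.toFinite {v | Sum.inl v ∈ D}).toFinset,
    (Set.toFinite {e | ∃ h : e ∈ G.edgeSet, Sum.inr ⟨e, h⟩ ∈ D}).toFinset, ⟨?_, ?_, ?_, ?_⟩, ?_⟩
  · intro u v h
    simp only [Set.Finite.mem_toFinset, Set.mem_ofPred_eq] at h
    exact h.1
  · intro v
    obtain ⟨x | ⟨e, he⟩, hx, hadj⟩ := h1 (Sum.inl v)
    · exact absurd hadj not_subdivision_adj_inl_inl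
    · rw [subdivision_adj_inl_inr] at hadj
      obtain ⟨u, rfl⟩ := Sym2.mem_iff_exists.1 hadj
      exact ⟨u, by simpa using ⟨he, hx⟩⟩
  · intro u v h
    obtain ⟨x | e, hx, hadj⟩ := h1 (Sum.inr ⟨s(u, v), h⟩)
    · rw [subdivision_adj_inr_inl] at hadj
      rcases Sym2.mem_iff.1 hadj with rfl | rfl
      · left; simpa using hx
      · right; simpa using hx
    · exact absurd hadj not_subdivision_adj_inr_inr
  · intro u v h hu
    simp only [Set.Finite.mem_toFinset, Set.mem_ofPred_eq] at hu ⊢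
    exact ⟨h, key h hu⟩
  · have hdec : D = Sum.inl '' {v | Sum.inl v ∈ D} ∪ Sum.inr '' {e | Sum.inr e ∈ D} := by
      ext (x | x) <;> simp
    have himg : {e | ∃ h : e ∈ G.edgeSet, Sum.inr ⟨e, h⟩ ∈ D} =
        Subtype.val '' {e : G.edgeSet | Sum.inr e ∈ D} := by
      ext e; simp
    rw [← Set.ncard_eq_toFinset_card, ← Set.ncard_eq_toFinset_card, himg,
      Set.ncard_image_of_injective _ Subtype.val_injective]
    conv_rhs => rw [hdec]
    rw [Set.ncard_union_eq (by
      rw [Set.disjoint_left]; rintro _ ⟨x, -, rfl⟩ ⟨y, -, h⟩; cases h) (Set.toFinite _)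
      (Set.toFinite _), Set.ncard_image_of_injective _ Sum.inl_injective,
      Set.ncard_image_of_injective _ Sum.inr_injective]

lemma IsMixedCover.exists_isTOIDS [Fintype V] {A : Finset V} {F : Finset (Sym2 V)}
    (h : IsMixedCover G A F) :
    ∃ D, IsTOIDS (subdivision G) D ∧ D.ncard = A.card + F.card := by
  classical
  refine ⟨Sum.inl '' (A : Set V) ∪ Sum.inr '' {e : G.edgeSet | (e : Sym2 V) ∈ F}, ⟨?_, ?_⟩, ?_⟩
  · rintro (v | ⟨e, he⟩)
    · obtain ⟨u, hu⟩ := h.cover v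
      exact ⟨Sum.inr ⟨s(v, u), h.adj hu⟩, by simpa using hu,
        subdivision_adj_inl_inr.2 (by simp)⟩
    · induction e with
      | _ u v =>
        rcases h.left_or_right he with hu | hu
        · exact ⟨Sum.inl u, by simpa using hu, subdivision_adj_inr_inl.2 (by simp)⟩
        · exact ⟨Sum.inl v, by simpa using hu, subdivision_adj_inr_inl.2 (by simp)⟩
  · have key : ∀ (v : V) (e : G.edgeSet), v ∉ A → (e : Sym2 V) ∉ F → v ∉ (e : Sym2 V) := by
      rintro v ⟨e, he⟩ hv hF hm
      obtain ⟨u, rfl⟩ := Sym2.mem_iff_exists.1 hm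
      exact hF (h.mem_of_notMem he hv)
    rintro (u | e) hu (v | f) hv hadj
    · exact not_subdivision_adj_inl_inl hadj
    · exact key u f (by simpa using hu) (by simpa using hv) (subdivision_adj_inl_inr.1 hadj)
    · exact key v e (by simpa using hv) (by simpa using hu) (subdivision_adj_inr_inl.1 hadj)
    · exact not_subdivision_adj_inr_inr hadj
  · have himg : (F : Set (Sym2 V)) = Subtype.val '' {e : G.edgeSet | (e : Sym2 V) ∈ F} := by
      ext e
      simp only [Finset.mem_coe, Set.mem_image, Set.mem_ofPred_eq, Subtype.exists, exists_and_left,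
        exists_prop, exists_eq_right_right]
      refine ⟨fun he => ⟨he, ?_⟩, fun he => he.1⟩
      induction e with
      | _ u v => exact h.adj he
    rw [Set.ncard_union_eq (by
      rw [Set.disjoint_left]; rintro _ ⟨x, -, rfl⟩ ⟨y, -, h⟩; cases h) (Set.toFinite _)
      (Set.toFinite _), Set.ncard_image_of_injective _ Sum.inl_injective,
      Set.ncard_image_of_injective _ Sum.inr_injective, Set.ncard_coe_finset,
      ← Set.ncard_coe_finset F, himg, Set.ncard_image_of_injective _ Subtype.val_injective]

lemma IsMixedCover.toidNumber_le [Fintype V] {A : Finset V} {F : Finset (Sym2 V)}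
    (h : IsMixedCover G A F) : toidNumber (subdivision G) ≤ A.card + F.card := by
  obtain ⟨D, hD, hc⟩ := h.exists_isTOIDS
  exact Nat.sInf_le ⟨D, hD, hc⟩

lemma exists_isMixedCover_card_eq_toidNumber [Fintype V] {A₀ : Finset V} {F₀ : Finset (Sym2 V)}
    (h : IsMixedCover G A₀ F₀) :
    ∃ A F, IsMixedCover G A F ∧ A.card + F.card = toidNumber (subdivision G) := by
  obtain ⟨D, hD, hc⟩ := h.exists_isTOIDS
  obtain ⟨D', hD', hc'⟩ := Nat.sInf_mem
    (s := {n : ℕ | ∃ D : Set _, IsTOIDS (subdivision G) D ∧ D.ncard = n}) ⟨_, D, hD, hc⟩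
  obtain ⟨A, F, hAF, hcard⟩ := hD'.exists_isMixedCover
  exact ⟨A, F, hAF, hcard.trans hc'⟩

open Classical in
lemma isMixedCover_univ [Fintype V] (h : ∀ v, ∃ u, G.Adj v u) :
    IsMixedCover G Finset.univ G.edgeFinset where
  adj := by simp
  cover v := by simpa using h v
  left_or_right := by simp
  mem_of_notMem := by simp

end Subdivision

/-- A vertex that is neither a leaf nor a support vertex. -/
def IsInnerVert {V : Type u} (G : SimpleGraph V) (v : V) : Prop :=
  ¬ IsLeafVert G v ∧ ¬ IsSupportVert G v

section Counting

open Finset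

variable {V : Type u} [Fintype V] {G : SimpleGraph V} {A : Finset V} {F : Finset (Sym2 V)}

open Classical in
lemma IsMixedCover.card_compl_le (h : IsMixedCover G A F) :
    #Aᶜ ≤ #{v | IsLeafVert G v} + #{v | v ∉ A ∧ IsInnerVert G v} := by
  have hsplit : Aᶜ = Aᶜ.filter (fun v => ¬ IsInnerVert G v) ∪
      ({v | v ∉ A ∧ IsInnerVert G v} : Finset V) := by
    ext v; simp; tauto
  have hrep : ∀ v, ∃ l, v ∉ A → ¬ IsInnerVert G v →
      IsLeafVert G l ∧ (l = v ∨ (G.Adj v l ∧ ¬ IsLeafVert G v)) := by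
    intro v
    by_cases hv : IsLeafVert G v
    · exact ⟨v, fun _ _ => ⟨hv, Or.inl rfl⟩⟩
    · by_cases hs : IsSupportVert G v
      · obtain ⟨l, hl, hl'⟩ := hs
        exact ⟨l, fun _ _ => ⟨hl', Or.inr ⟨hl, hv⟩⟩⟩
      · exact ⟨v, fun _ hi => absurd ⟨hv, hs⟩ hi⟩
  choose f hf using hrep
  have hinj : #(Aᶜ.filter fun v => ¬ IsInnerVert G v) ≤ #{v | IsLeafVert G v} := by
    refine card_le_card_of_injOn f ?_ ?_
    · intro v hv
      simp only [coe_filter, mem_compl, Set.mem_ofPred_eq] at hv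
      simpa using (hf v hv.1 hv.2).1
    · intro v hv v' hv' hvv'
      simp only [coe_filter, mem_compl, Set.mem_ofPred_eq] at hv hv'
      obtain ⟨h1, h2⟩ := hf v hv.1 hv.2
      obtain ⟨h1', h2'⟩ := hf v' hv'.1 hv'.2
      rcases h2 with h2 | ⟨h2, -⟩ <;> rcases h2' with h2' | ⟨h2', -⟩
      · rw [← h2, ← h2', hvv']
      · rw [← hvv', h2] at h2'
        rcases h.left_or_right h2' with hA | hA
        · exact absurd hA hv'.1
        · exact absurd hA hv.1
      · rw [hvv', h2'] at h2
        rcases h.left_or_right h2 with hA | hA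
        · exact absurd hA hv.1
        · exact absurd hA hv'.1
      · rw [← hvv'] at h2'
        exact h1.unique h2.symm h2'.symm
  rw [hsplit]
  exact (card_union_le _ _).trans (Nat.add_le_add_right hinj _)

open Classical in
lemma IsMixedCover.card_leaves_le (h : IsMixedCover G A F)
    (hleaf : ∀ u v, G.Adj u v → IsLeafVert G u → ¬ IsLeafVert G v) :
    #{v | IsLeafVert G v} ≤ #{e ∈ F | ∃ v ∈ e, IsLeafVert G v} := by
  choose f hf using h.cover
  refine card_le_card_of_injOn (fun v => s(v, f v)) ?_ ?_
  · intro v hv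
    simp only [coe_filter, mem_univ, true_and, Set.mem_ofPred_eq] at hv ⊢
    exact ⟨hf v, v, by simp, hv⟩
  · intro v hv v' hv' hvv'
    simp only [coe_filter, mem_univ, true_and, Set.mem_ofPred_eq] at hv hv'
    rcases Sym2.eq_iff.1 hvv' with ⟨h1, -⟩ | ⟨h1, h2⟩
    · exact h1
    · exact absurd hv' (hleaf v v' (h2 ▸ h.adj (hf v)) hv)

open Classical in
lemma two_le_card_incidenceFinset (hne : ∀ v, ∃ u, G.Adj v u) {v : V}
    (hv : ¬ IsLeafVert G v) : 2 ≤ #(G.incidenceFinset v) := by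
  rw [card_incidenceFinset_eq_degree, ← card_neighborFinset_eq_degree]
  obtain ⟨u, hu⟩ := hne v
  by_contra hc
  have h1 : #(G.neighborFinset v) ≤ 1 := by omega
  exact hv ⟨u, hu, fun w hw => card_le_one.1 h1 w (by simpa using hw) u (by simpa using hu)⟩

open Classical in
lemma IsMixedCover.card_biUnion_incidenceFinset (h : IsMixedCover G A F) (J : Finset V)
    (hJ : ∀ v ∈ J, v ∉ A) :
    #(J.biUnion fun v => G.incidenceFinset v) = ∑ v ∈ J, #(G.incidenceFinset v) := by
  refine card_biUnion fun v hv v' hv' hne => Finset.disjoint_left.2 fun e he he' => ?_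
  rw [mem_incidenceFinset] at he he'
  have hadj : G.Adj v v' := by
    obtain ⟨he, hve⟩ := he
    rw [(Sym2.mem_and_mem_iff hne).1 ⟨hve, he'.2⟩] at he
    exact he
  rcases h.left_or_right hadj with hA | hA
  · exact hJ _ hv hA
  · exact hJ _ hv' hA

open Classical in
/-- The counting estimate behind the lower bound for the total outer-independent domination number
of a subdivision graph, together with the structure forced by equality. -/
theorem IsMixedCover.four_mul_card_le (h : IsMixedCover G A F)
    (hleaf : ∀ u v, G.Adj u v → IsLeafVert G u → ¬ IsLeafVert G v) :
    4 * Fintype.card V ≤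
      3 * (#A + #F) + #{v | IsLeafVert G v} + #{v | IsSupportVert G v} ∧
    (3 * (#A + #F) + #{v | IsLeafVert G v} + #{v | IsSupportVert G v} ≤ 4 * Fintype.card V →
      (∀ v, v ∉ A → IsInnerVert G v → G.degree v = 2) ∧
      (∀ v u, v ∉ A → IsInnerVert G v → G.Adj v u → IsInnerVert G u) ∧
      (∀ v, v ∈ A → IsInnerVert G v → ∃ u, u ∉ A ∧ IsInnerVert G u ∧ G.Adj v u)) := by
  have hne : ∀ v, ∃ u, G.Adj v u := fun v => (h.cover v).imp fun u hu => h.adj hu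
  set L : Finset V := {v | IsLeafVert G v} with hL
  set S : Finset V := {v | IsSupportVert G v} with hS
  set J : Finset V := {v | v ∉ A ∧ IsInnerVert G v} with hJ
  set M : Finset V := {v | v ∈ A ∧ IsInnerVert G v} with hM
  set E₁ : Finset (Sym2 V) := J.biUnion fun v => G.incidenceFinset v with hE₁
  set EL : Finset (Sym2 V) := {e ∈ F | ∃ v ∈ e, IsLeafVert G v} with hEL
  set E₂ : Finset (Sym2 V) := (F \ EL) \ E₁ with hE₂
  have hmemL : ∀ v, v ∈ L ↔ IsLeafVert G v := by simp [hL]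
  have hmemS : ∀ v, v ∈ S ↔ IsSupportVert G v := by simp [hS]
  have hmemJ : ∀ v, v ∈ J ↔ v ∉ A ∧ IsInnerVert G v := by simp [hJ]
  have hmemM : ∀ v, v ∈ M ↔ v ∈ A ∧ IsInnerVert G v := by simp [hM]
  have hmemE₁ : ∀ e, e ∈ E₁ ↔ ∃ v ∈ J, e ∈ G.incidenceSet v := by simp [hE₁]
  have hI : #Aᶜ ≤ #L + #J := h.card_compl_le
  have hcompl : #Aᶜ + #A = Fintype.card V := card_compl_add_card A
  have hlS : Disjoint L S := by
    rw [Finset.disjoint_left]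
    intro v hv hs
    rw [hmemL] at hv
    rw [hmemS] at hs
    obtain ⟨u, hu, hu'⟩ := hs
    exact hleaf v u hu hv hu'
  have hpart : #L + #S + #J + #M = Fintype.card V := by
    rw [← card_union_of_disjoint hlS, ← card_union_of_disjoint, ← card_union_of_disjoint,
      ← card_univ]
    · congr 1
      ext v
      simp only [mem_union, mem_univ, iff_true, hmemL, hmemS, hmemJ, hmemM, IsInnerVert]
      tauto
    · rw [Finset.disjoint_left]
      intro v
      simp only [mem_union, hmemL, hmemS, hmemJ, hmemM, IsInnerVert]
      tauto
    · rw [Finset.disjoint_left]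
      intro v
      simp only [mem_union, hmemL, hmemS, hmemJ, IsInnerVert]
      tauto
  have hELc : #L ≤ #EL := h.card_leaves_le hleaf
  have hE₁F : E₁ ⊆ F \ EL := by
    intro e he
    obtain ⟨v, hv, he, hve⟩ := (hmemE₁ e).1 he
    obtain ⟨u, rfl⟩ := Sym2.mem_iff_exists.1 hve
    rw [hmemJ] at hv
    refine mem_sdiff.2 ⟨h.mem_of_notMem he hv.1, fun hc => ?_⟩
    obtain ⟨x, hx, hxl⟩ := (mem_filter.1 hc).2
    rcases Sym2.mem_iff.1 hx with rfl | rfl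
    · exact hv.2.1 hxl
    · exact hv.2.2 ⟨x, he, hxl⟩
  have hF : #F = #EL + #E₁ + #E₂ := by
    have h1 := card_sdiff_add_card_eq_card hE₁F
    rw [← hE₂] at h1
    have hELF : EL ⊆ F := filter_subset _ _
    have h2 := card_sdiff_add_card_eq_card hELF
    omega
  have hsum : #E₁ = ∑ v ∈ J, #(G.incidenceFinset v) :=
    h.card_biUnion_incidenceFinset J fun v hv => ((hmemJ v).1 hv).1
  have htwo : ∀ v ∈ J, 2 ≤ #(G.incidenceFinset v) := by
    intro v hv
    rw [hmemJ] at hv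
    exact two_le_card_incidenceFinset hne hv.2.1
  have hdeg : ∑ _v ∈ J, 2 ≤ ∑ v ∈ J, #(G.incidenceFinset v) := sum_le_sum htwo
  have hconst : ∑ _v ∈ J, 2 = 2 * #J := by simp [mul_comm]
  have hMedge : ∀ v ∈ M, ∃ e ∈ E₁ ∪ E₂, v ∈ e := by
    intro v hv
    rw [hmemM] at hv
    obtain ⟨u, hu⟩ := h.cover v
    refine ⟨s(v, u), ?_, by simp⟩
    have : s(v, u) ∉ EL := by
      intro hc
      obtain ⟨x, hx, hxl⟩ := (mem_filter.1 hc).2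
      rcases Sym2.mem_iff.1 hx with rfl | rfl
      · exact hv.2.1 hxl
      · exact hv.2.2 ⟨x, h.adj hu, hxl⟩
    simp only [hE₂, mem_union, mem_sdiff]
    tauto
  have hcover : #M ≤ ∑ e ∈ E₁ ∪ E₂, #{v ∈ M | v ∈ e} := by
    refine (card_le_card ?_).trans card_biUnion_le
    intro v hv
    obtain ⟨e, he, hve⟩ := hMedge v hv
    exact mem_biUnion.2 ⟨e, he, mem_filter.2 ⟨hv, hve⟩⟩
  rw [sum_union (by rw [hE₂]; exact disjoint_sdiff)] at hcover
  have hone : ∀ e ∈ E₁, #{v ∈ M | v ∈ e} ≤ 1 := by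
    intro e he
    obtain ⟨v, hv, -, hve⟩ := (hmemE₁ e).1 he
    obtain ⟨u, rfl⟩ := Sym2.mem_iff_exists.1 hve
    refine (card_le_card (t := {u}) fun x hx => ?_).trans (card_singleton u).le
    obtain ⟨hxM, hx⟩ := mem_filter.1 hx
    rw [hmemM] at hxM
    rw [hmemJ] at hv
    rcases Sym2.mem_iff.1 hx with rfl | rfl
    · exact absurd hxM.1 hv.1
    · simp
  have htwo' : ∀ e ∈ E₂, #{v ∈ M | v ∈ e} ≤ 2 := by
    intro e _
    induction e with
    | _ u v =>
      refine (card_le_card (t := {u, v}) fun x hx => ?_).trans card_le_two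
      simpa using (mem_filter.1 hx).2
  have hsum₁ : ∑ e ∈ E₁, #{v ∈ M | v ∈ e} ≤ ∑ _e ∈ E₁, 1 := sum_le_sum hone
  have hsum₂ : ∑ e ∈ E₂, #{v ∈ M | v ∈ e} ≤ ∑ _e ∈ E₂, 2 := sum_le_sum htwo'
  have hconst₁ : ∑ _e ∈ E₁, 1 = #E₁ := by simp
  have hconst₂ : ∑ _e ∈ E₂, 2 = 2 * #E₂ := by simp [mul_comm]
  refine ⟨by omega, fun heq => ⟨?_, ?_, ?_⟩⟩
  · intro v hvA hv
    have := (sum_eq_sum_iff_of_le htwo).1 (by omega) v ((hmemJ v).2 ⟨hvA, hv⟩)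
    rw [← card_incidenceFinset_eq_degree, ← this]
  · intro v u hvA hv hvu
    have hvJ : v ∈ J := (hmemJ v).2 ⟨hvA, hv⟩
    have := (sum_eq_sum_iff_of_le hone).1 (by omega) s(v, u)
      ((hmemE₁ _).2 ⟨v, hvJ, hvu, by simp⟩)
    obtain ⟨x, hx⟩ := card_pos.1 (this ▸ one_pos)
    obtain ⟨hxM, hx⟩ := mem_filter.1 hx
    rw [hmemM] at hxM
    rcases Sym2.mem_iff.1 hx with rfl | rfl
    · exact absurd hxM.1 hvA
    · exact hxM.2
  · intro v hvA hv
    have hE₂0 : E₂ = ∅ := card_eq_zero.1 (by omega)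
    obtain ⟨e, he, hve⟩ := hMedge v ((hmemM v).2 ⟨hvA, hv⟩)
    rw [hE₂0, union_empty] at he
    obtain ⟨u, hu, he, hue⟩ := (hmemE₁ e).1 he
    rw [hmemJ] at hu
    have hvu : v ≠ u := by rintro rfl; exact hu.1 hvA
    rw [(Sym2.mem_and_mem_iff hvu).1 ⟨hve, hue⟩] at he
    exact ⟨u, hu.1, hu.2, he⟩

end Counting

section Counts

variable {V : Type u} {G : SimpleGraph V}

lemma card_ne_two_of_not_adj_leaves (hne : ∀ v, ∃ u, G.Adj v u)
    (hleaf : ∀ u v, G.Adj u v → IsLeafVert G u → ¬ IsLeafVert G v) : Nat.card V ≠ 2 := by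
  intro h2
  obtain ⟨x, y, hxy, huniv⟩ := Nat.card_eq_two_iff.1 h2
  have hall : ∀ z, z = x ∨ z = y := fun z => by
    have hz : z ∈ ({x, y} : Set V) := huniv ▸ Set.mem_univ z
    simpa using hz
  have hx : ∀ u, G.Adj x u → u = y := fun u hu => (hall u).resolve_left hu.ne'
  have hy : ∀ u, G.Adj y u → u = x := fun u hu => (hall u).resolve_right hu.ne'
  obtain ⟨u, hu⟩ := hne x
  obtain rfl := hx u hu
  exact hleaf x u hu ⟨u, hu, hx⟩ ⟨x, hu.symm, hy⟩

open Classical in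
lemma leafCount_eq_card_filter [Fintype V] (h : Nat.card V ≠ 2) :
    leafCount G = Finset.card {v | IsLeafVert G v} := by
  rw [leafCount, if_neg h, ← Set.ncard_coe_finset]
  simp

open Classical in
lemma supportCount_eq_card_filter [Fintype V] (h : Nat.card V ≠ 2) :
    supportCount G = Finset.card {v | IsSupportVert G v} := by
  rw [supportCount, if_neg h, ← Set.ncard_coe_finset]
  simp

end Counts

lemma adj_iff_of_degree_eq_two {V : Type u} [Fintype V] {G : SimpleGraph V}
    [DecidableRel G.Adj] {v x y : V} (hv : G.degree v = 2) (hx : G.Adj v x) (hy : G.Adj v y)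
    (hxy : x ≠ y) (u : V) : G.Adj v u ↔ u = x ∨ u = y := by
  classical
  have h : ({x, y} : Finset V) = G.neighborFinset v := by
    refine Finset.eq_of_subset_of_card_le ?_ ?_
    · intro z hz
      rcases Finset.mem_insert.1 hz with rfl | hz
      · simpa using hx
      · rw [Finset.mem_singleton.1 hz]; simpa using hy
    · rw [card_neighborFinset_eq_degree, hv, Finset.card_pair hxy]
  rw [← mem_neighborFinset, ← h]
  simp

section RemovePath

open Finset

variable {V : Type u} [Fintype V] {G : SimpleGraph V}

open Classical in
/-- Removing a pendant path `x₀ x₁ x₂`, attached at a non-leaf `x₃`, from a graph attaining the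
lower bound leaves a graph attaining the lower bound in which `x₃` is a weak leaf. -/
theorem isWeakLeaf_and_toidNumber_eq_of_pendant_path
    (hne : ∀ v, ∃ u, G.Adj v u)
    (hleaf : ∀ u v, G.Adj u v → IsLeafVert G u → ¬ IsLeafVert G v)
    {x₀ x₁ x₂ x₃ : V} (h₀ : ∀ u, G.Adj x₀ u ↔ u = x₁) (h₁ : ∀ u, G.Adj x₁ u ↔ u = x₀ ∨ u = x₂)
    (h₂ : ∀ u, G.Adj x₂ u ↔ u = x₁ ∨ u = x₃) (h02 : x₀ ≠ x₂) (h13 : x₁ ≠ x₃)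
    (h₃ : ¬ IsLeafVert G x₃)
    (heq : 3 * toidNumber (subdivision G) + leafCount G + supportCount G = 4 * Nat.card V) :
    (∃ h : x₃ ∈ {x : V | x ≠ x₀ ∧ x ≠ x₁ ∧ x ≠ x₂},
      IsWeakLeaf (G.induce {x : V | x ≠ x₀ ∧ x ≠ x₁ ∧ x ≠ x₂}) ⟨x₃, h⟩) ∧
    3 * toidNumber (subdivision (G.induce {x : V | x ≠ x₀ ∧ x ≠ x₁ ∧ x ≠ x₂})) +
      leafCount (G.induce {x : V | x ≠ x₀ ∧ x ≠ x₁ ∧ x ≠ x₂}) +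
      supportCount (G.induce {x : V | x ≠ x₀ ∧ x ≠ x₁ ∧ x ≠ x₂}) =
      4 * Nat.card {x : V | x ≠ x₀ ∧ x ≠ x₁ ∧ x ≠ x₂} := by
  have a01 : G.Adj x₀ x₁ := (h₀ _).2 rfl
  have a12 : G.Adj x₁ x₂ := (h₁ _).2 (Or.inr rfl)
  have a23 : G.Adj x₂ x₃ := (h₂ _).2 (Or.inr rfl)
  have h03 : x₀ ≠ x₃ := by
    rintro rfl
    exact a12.ne' ((h₀ _).1 a23.symm)
  have hcard2 := card_ne_two_of_not_adj_leaves hne hleaf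
  rw [leafCount_eq_card_filter hcard2, supportCount_eq_card_filter hcard2,
    Nat.card_eq_fintype_card] at heq
  obtain ⟨A, F, h, hAF⟩ := exists_isMixedCover_card_eq_toidNumber (isMixedCover_univ hne)
  obtain ⟨hdeg, hinner, hnbr⟩ := (h.four_mul_card_le hleaf).2 (by rw [hAF]; omega)
  -- the structure of the extremal cover along the path
  have hl0 : IsLeafVert G x₀ := ⟨x₁, a01, fun u hu => (h₀ u).1 hu⟩
  have hx₁ : ¬ IsInnerVert G x₁ := fun hi => hi.2 ⟨x₀, a01.symm, hl0⟩
  have hx₂ : IsInnerVert G x₂ := by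
    refine ⟨fun hl => h13 (hl.unique a12.symm a23), ?_⟩
    rintro ⟨u, hu, hul⟩
    rcases (h₂ u).1 hu with rfl | rfl
    · exact h02 (hul.unique a01.symm a12)
    · exact h₃ hul
  have hx₂A : x₂ ∈ A := by
    by_contra hc
    exact hx₁ (hinner x₂ x₁ hc hx₂ a12.symm)
  obtain ⟨hx₃A, hx₃⟩ : x₃ ∉ A ∧ IsInnerVert G x₃ := by
    obtain ⟨u, huA, hu, hadj⟩ := hnbr x₂ hx₂A hx₂
    rcases (h₂ u).1 hadj with rfl | rfl
    · exact absurd hu hx₁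
    · exact ⟨huA, hu⟩
  obtain ⟨x₄, a34, h24⟩ : ∃ x₄, G.Adj x₃ x₄ ∧ x₂ ≠ x₄ := by
    by_contra! hc
    exact h₃ ⟨x₂, a23.symm, fun u hu => (hc u hu).symm⟩
  have h₃' := adj_iff_of_degree_eq_two (hdeg x₃ hx₃A hx₃) a23.symm a34 h24
  have hx₄ : IsInnerVert G x₄ := hinner x₃ x₄ hx₃A hx₃ a34
  have h04 : x₀ ≠ x₄ := by
    rintro rfl
    exact h13 ((h₀ _).1 a34.symm).symm
  have h14 : x₁ ≠ x₄ := by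
    rintro rfl
    exact hx₁ hx₄
  set s : Set V := {x : V | x ≠ x₀ ∧ x ≠ x₁ ∧ x ≠ x₂} with hs
  have hmem : ∀ x, x ∈ s ↔ x ≠ x₀ ∧ x ≠ x₁ ∧ x ≠ x₂ := fun x => Iff.rfl
  have hx₃s : x₃ ∈ s := ⟨h03.symm, h13.symm, a23.ne'⟩
  have hx₄s : x₄ ∈ s := ⟨h04.symm, h14.symm, h24.symm⟩
  have hsep : ∀ x ∈ s, x ≠ x₃ → ∀ u, G.Adj x u → u ∈ s := by
    intro x hx hx3 u hu
    refine ⟨?_, ?_, ?_⟩ <;> rintro rfl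
    · exact hx.2.1 ((h₀ _).1 hu.symm)
    · rcases (h₁ _).1 hu.symm with h | h
      · exact hx.1 h
      · exact hx.2.2 h
    · rcases (h₂ _).1 hu.symm with h | h
      · exact hx.2.1 h
      · exact hx3 h
  have hadj : ∀ u v : s, (G.induce s).Adj u v ↔ G.Adj u v := fun u v => Iff.rfl
  have hleaf_of : ∀ x : s, (x : V) ≠ x₃ → IsLeafVert (G.induce s) x → IsLeafVert G x := by
    rintro ⟨x, hx⟩ hx3 ⟨u, hu, huniq⟩
    exact ⟨u, hu, fun v hv => congrArg Subtype.val (huniq ⟨v, hsep x hx hx3 v hv⟩ hv)⟩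
  have hnbr₃ : ∀ u : s, (G.induce s).Adj ⟨x₃, hx₃s⟩ u → u = ⟨x₄, hx₄s⟩ := by
    rintro ⟨u, hu⟩ hadj
    rcases (h₃' u).1 hadj with h | h
    · exact absurd h hu.2.2
    · exact Subtype.ext h
  have hleaf₃ : IsLeafVert (G.induce s) ⟨x₃, hx₃s⟩ := ⟨⟨x₄, hx₄s⟩, a34, hnbr₃⟩
  -- the induced cover of the remaining graph
  set A' : Finset s := {v | (v : V) ∈ A} with hA'
  set F' : Finset (Sym2 s) := {e | e.map Subtype.val ∈ F} with hF'
  have hmemF' : ∀ u v : s, s(u, v) ∈ F' ↔ s((u : V), (v : V)) ∈ F := by simp [hF']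
  have h' : IsMixedCover (G.induce s) A' F' := by
    refine ⟨fun {u v} huv => h.adj ((hmemF' u v).1 huv), ?_, ?_, ?_⟩
    · rintro ⟨v, hv⟩
      by_cases hv3 : v = x₃
      · subst hv3
        exact ⟨⟨x₄, hx₄s⟩, (hmemF' _ _).2 (h.mem_of_notMem a34 hx₃A)⟩
      · obtain ⟨u, hu⟩ := h.cover v
        exact ⟨⟨u, hsep v hv hv3 u (h.adj hu)⟩, (hmemF' _ _).2 hu⟩
    · intro u v huv
      simpa [hA'] using h.left_or_right ((hadj u v).1 huv)
    · intro u v huv hu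
      exact (hmemF' u v).2 (h.mem_of_notMem huv (by simpa [hA'] using hu))
  have hAcard : #A' + 2 ≤ #A := by
    obtain ⟨y, hyA, hys, hy2⟩ : ∃ y ∈ A, y ∉ s ∧ y ≠ x₂ := by
      rcases h.left_or_right a01 with hy | hy
      · exact ⟨x₀, hy, fun hc => hc.1 rfl, h02⟩
      · exact ⟨x₁, hy, fun hc => hc.2.1 rfl, a12.ne⟩
    have hsub : A'.image Subtype.val ⊆ (A.erase x₂).erase y := by
      intro x hx
      obtain ⟨⟨x, hxs⟩, hxA, rfl⟩ := mem_image.1 hx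
      exact mem_erase.2 ⟨fun hc => hys (hc ▸ hxs), mem_erase.2 ⟨hxs.2.2, (mem_filter.1 hxA).2⟩⟩
    have hle := card_le_card hsub
    rw [card_image_of_injective _ Subtype.val_injective] at hle
    have c1 := card_erase_add_one hx₂A
    have c2 := card_erase_add_one (mem_erase.2 ⟨hy2, hyA⟩)
    omega
  have hFcard : #F' + 2 ≤ #F := by
    have e23 : s(x₂, x₃) ∈ F := by
      rw [Sym2.eq_swap]
      exact h.mem_of_notMem a23.symm hx₃A
    have e01 : s(x₀, x₁) ∈ F := by
      obtain ⟨u, hu⟩ := h.cover x₀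
      rwa [(h₀ u).1 (h.adj hu)] at hu
    have hne' : s(x₀, x₁) ≠ s(x₂, x₃) := by
      simp [h02, h03]
    have hnotMem : ∀ e ∈ F'.image (Sym2.map Subtype.val), ∀ y ∈ e, y ∈ s := by
      intro e he y hy
      obtain ⟨e, -, rfl⟩ := mem_image.1 he
      obtain ⟨z, -, rfl⟩ := Sym2.mem_map.1 hy
      exact z.2
    have hsub : F'.image (Sym2.map Subtype.val) ⊆ (F.erase s(x₂, x₃)).erase s(x₀, x₁) := by
      intro e he
      refine mem_erase.2 ⟨?_, mem_erase.2 ⟨?_, ?_⟩⟩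
      · rintro rfl
        exact (hnotMem _ he x₀ (by simp)).1 rfl
      · rintro rfl
        exact (hnotMem _ he x₂ (by simp)).2.2 rfl
      · obtain ⟨e, he', rfl⟩ := mem_image.1 he
        exact (mem_filter.1 he').2
    have hle := card_le_card hsub
    rw [card_image_of_injective _ (Sym2.map.injective Subtype.val_injective)] at hle
    have c1 := card_erase_add_one e23
    have c2 := card_erase_add_one (mem_erase.2 ⟨hne', e01⟩)
    omega
  -- comparison of orders, leaves and support vertices
  have hVcard : Fintype.card s + 3 = Fintype.card V := by
    have h3 : #({x₀, x₁, x₂} : Finset V) = 3 := card_eq_three.2 ⟨_, _, _, a01.ne, h02, a12.ne, rfl⟩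
    rw [Fintype.card_subtype, ← card_compl_add_card ({x₀, x₁, x₂} : Finset V), h3]
    congr 2
    ext x
    simp [hmem]
  have hLcard : #{v | IsLeafVert (G.induce s) v} ≤ #{v | IsLeafVert G v} := by
    have hsub : (univ.filter (IsLeafVert (G.induce s))).image Subtype.val ⊆
        insert x₃ ((univ.filter (IsLeafVert G)).erase x₀) := by
      intro x hx
      obtain ⟨x, hxl, rfl⟩ := mem_image.1 hx
      by_cases hx3 : (x : V) = x₃
      · exact mem_insert.2 (Or.inl hx3)
      · exact mem_insert.2 (Or.inr (mem_erase.2 ⟨x.2.1,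
          mem_filter.2 ⟨mem_univ _, hleaf_of x hx3 (mem_filter.1 hxl).2⟩⟩))
    have hle := (card_le_card hsub).trans (card_insert_le _ _)
    rwa [card_image_of_injective _ Subtype.val_injective,
      card_erase_add_one (by simpa using hl0)] at hle
  have hScard : #{v | IsSupportVert (G.induce s) v} ≤ #{v | IsSupportVert G v} := by
    have hsub : (univ.filter (IsSupportVert (G.induce s))).image Subtype.val ⊆
        insert x₄ ((univ.filter (IsSupportVert G)).erase x₁) := by
      intro x hx
      obtain ⟨x, hxl, rfl⟩ := mem_image.1 hx
      obtain ⟨u, hu, hul⟩ := (mem_filter.1 hxl).2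
      by_cases hu3 : (u : V) = x₃
      · obtain rfl : u = ⟨x₃, hx₃s⟩ := Subtype.ext hu3
        exact mem_insert.2 (Or.inl (congrArg Subtype.val (hnbr₃ x hu.symm)))
      · exact mem_insert.2 (Or.inr (mem_erase.2 ⟨x.2.2.1,
          mem_filter.2 ⟨mem_univ _, u, hu, hleaf_of u hu3 hul⟩⟩))
    have hle := (card_le_card hsub).trans (card_insert_le _ _)
    rwa [card_image_of_injective _ Subtype.val_injective,
      card_erase_add_one (by simpa using ⟨x₀, a01.symm, hl0⟩)] at hle
  have hleaf' : ∀ u v, (G.induce s).Adj u v → IsLeafVert (G.induce s) u →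
      ¬ IsLeafVert (G.induce s) v := by
    have key : ∀ u v, (G.induce s).Adj u v → (u : V) = x₃ → ¬ IsLeafVert (G.induce s) v := by
      intro u v huv hu3 hv
      obtain rfl : u = ⟨x₃, hx₃s⟩ := Subtype.ext hu3
      obtain rfl := hnbr₃ v huv
      exact hx₄.1 (hleaf_of _ a34.ne' hv)
    intro u v huv hu hv
    by_cases hu3 : (u : V) = x₃
    · exact key u v huv hu3 hv
    · by_cases hv3 : (v : V) = x₃
      · exact key v u huv.symm hv3 hu
      · exact hleaf u v huv (hleaf_of u hu3 hu) (hleaf_of v hv3 hv)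
  have hcard2' := card_ne_two_of_not_adj_leaves
    (fun v => (h'.cover v).imp fun u hu => h'.adj hu) hleaf'
  obtain ⟨B, E, hBE, hBEcard⟩ := exists_isMixedCover_card_eq_toidNumber h'
  have hlower := (hBE.four_mul_card_le hleaf').1
  have hupper := h'.toidNumber_le
  refine ⟨⟨hx₃s, hleaf₃, ?_⟩, ?_⟩
  · rintro ⟨-, u, hu, w₁, w₂, hw, hw₁, hw₂, hl₁, hl₂⟩
    obtain rfl := hnbr₃ u hu
    by_cases hw3 : (w₁ : V) = x₃
    · exact hx₄.2 ⟨w₂, hw₂, hleaf_of w₂ (fun hc => hw (Subtype.ext (hw3.trans hc.symm))) hl₂⟩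
    · exact hx₄.2 ⟨w₁, hw₁, hleaf_of w₁ hw3 hl₁⟩
  · rw [leafCount_eq_card_filter hcard2', supportCount_eq_card_filter hcard2',
      Nat.card_eq_fintype_card]
    omega

end RemovePath

section Tree

variable {V : Type u} {T : SimpleGraph V}

lemma eq_getVert_one_of_adj_of_length_eq_diam [Finite V] (hT : T.IsTree) {a b : V}
    {w : T.Walk a b} (hw : w.IsPath) (hd : w.length = T.diam) {y : V} (hy : T.Adj a y) :
    y = w.getVert 1 := by
  classical
  obtain ⟨p, hp, hlen⟩ := hT.1.exists_path_of_dist y b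
  have hle : p.length ≤ w.length := by
    rw [hlen, hd]
    have := hT.1.nonempty
    exact dist_le_diam (connected_iff_ediam_ne_top.1 hT.1)
  by_cases ha : a ∈ p.support
  · have h1 : p.dropUntil a ha = w :=
      congrArg Subtype.val ((hT.2.subsingleton_path _ _).elim ⟨_, hp.dropUntil ha⟩ ⟨w, hw⟩)
    have h2 := congrArg Walk.length (p.take_spec ha)
    rw [Walk.length_append, h1] at h2
    exact absurd (Walk.eq_of_length_eq_zero (p := p.takeUntil a ha) (by omega)) hy.ne'
  · have h1 : Walk.cons hy p = w :=
      congrArg Subtype.val ((hT.2.subsingleton_path _ _).elim ⟨_, hp.cons ha⟩ ⟨w, hw⟩)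
    rw [← h1]
    simp

lemma SimpleGraph.Connected.mem_of_forall_adj (hT : T.Connected) {s : Set V} {x : V} (hx : x ∈ s)
    (hs : ∀ u ∈ s, ∀ v, T.Adj u v → v ∈ s) (y : V) : y ∈ s := by
  obtain ⟨p⟩ := hT x y
  induction p with
  | nil => exact hx
  | cons hadj p ih => exact ih (hs _ hx _ hadj)

lemma not_adj_leaves_of_connected (hT : T.Connected) (hn : 3 ≤ Nat.card V) (u v : V)
    (huv : T.Adj u v) (hu : IsLeafVert T u) : ¬ IsLeafVert T v := by
  intro hv
  have huniv : ({u, v} : Set V) = Set.univ := by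
    refine Set.eq_univ_of_forall (hT.mem_of_forall_adj (x := u) (by simp) ?_)
    rintro x (rfl | rfl) y hxy
    · exact Or.inr (hu.unique hxy huv)
    · exact Or.inl (hv.unique hxy huv.symm)
  have := Set.ncard_pair huv.ne
  rw [huniv, Set.ncard_univ] at this
  omega

lemma nonempty_iso_pathGraph_four (hT : T.Connected) {x₀ x₁ x₂ x₃ : V}
    (h₀ : ∀ u, T.Adj x₀ u ↔ u = x₁) (h₁ : ∀ u, T.Adj x₁ u ↔ u = x₀ ∨ u = x₂)
    (h₂ : ∀ u, T.Adj x₂ u ↔ u = x₁ ∨ u = x₃) (h₃ : ∀ u, T.Adj x₃ u ↔ u = x₂)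
    (h02 : x₀ ≠ x₂) (h03 : x₀ ≠ x₃) (h13 : x₁ ≠ x₃) :
    Nonempty (T ≃g SimpleGraph.pathGraph 4) := by
  have h01 : x₀ ≠ x₁ := ((h₀ x₁).2 rfl).ne
  have h12 : x₁ ≠ x₂ := ((h₁ x₂).2 (Or.inr rfl)).ne
  have h23 : x₂ ≠ x₃ := ((h₂ x₃).2 (Or.inr rfl)).ne
  have hinj : Function.Injective ![x₀, x₁, x₂, x₃] := by
    intro i j hij
    fin_cases i <;> fin_cases j <;> simp_all [eq_comm]
  have hsurj : Function.Surjective ![x₀, x₁, x₂, x₃] := by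
    refine hT.mem_of_forall_adj (s := Set.range ![x₀, x₁, x₂, x₃]) ⟨0, rfl⟩ ?_
    rintro _ ⟨i, rfl⟩ v hv
    fin_cases i
    · exact ⟨1, ((h₀ v).1 hv).symm⟩
    · rcases (h₁ v).1 hv with rfl | rfl
      · exact ⟨0, rfl⟩
      · exact ⟨2, rfl⟩
    · rcases (h₂ v).1 hv with rfl | rfl
      · exact ⟨1, rfl⟩
      · exact ⟨3, rfl⟩
    · exact ⟨2, ((h₃ v).1 hv).symm⟩
  refine ⟨RelIso.symm ⟨Equiv.ofBijective _ ⟨hinj, hsurj⟩, ?_⟩⟩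
  intro i j
  change T.Adj (![x₀, x₁, x₂, x₃] i) (![x₀, x₁, x₂, x₃] j) ↔ _
  fin_cases i <;> fin_cases j <;>
    simp [pathGraph_adj, h₀, h₁, h₂, h₃, h01, h02, h03, h12, h13, h02.symm,
      h03.symm, h12.symm, h13.symm, h23.symm]

end Tree

theorem claimIII_lower {V : Type u} [Fintype V] [DecidableEq V]
    (T : SimpleGraph V) [DecidableRel T.Adj] (hT : T.IsTree) (hn : 3 ≤ Nat.card V)
    (hP4 : ¬ Nonempty (T ≃g SimpleGraph.pathGraph 4))
    (heq : (toidNumber (subdivision T) : ℚ) = (4 * (Nat.card V : ℚ) - leafCount T - supportCount T) / 3)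
    {a b : V} (w : T.Walk a b) (hw : w.IsPath) (hd : w.length = T.diam)
    (hdeg2 : T.degree (w.getVert 1) = 2) (hdeg3 : T.degree (w.getVert 2) = 2) :
    (∃ h : w.getVert 3 ∈ {x : V | x ≠ a ∧ x ≠ w.getVert 1 ∧ x ≠ w.getVert 2},
      IsWeakLeaf (T.induce {x : V | x ≠ a ∧ x ≠ w.getVert 1 ∧ x ≠ w.getVert 2}) ⟨w.getVert 3, h⟩) ∧
    (toidNumber (subdivision (T.induce {x : V | x ≠ a ∧ x ≠ w.getVert 1 ∧ x ≠ w.getVert 2})) : ℚ) = (4 * (Nat.card {x : V | x ≠ a ∧ x ≠ w.getVert 1 ∧ x ≠ w.getVert 2} : ℚ) - leafCount (T.induce {x : V | x ≠ a ∧ x ≠ w.getVert 1 ∧ x ≠ w.getVert 2}) - supportCount (T.induce {x : V | x ≠ a ∧ x ≠ w.getVert 1 ∧ x ≠ w.getVert 2})) / 3 := by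
  have hinj := hw.getVert_injOn
  have hconn := hT.1
  have hnt : Nontrivial V := Finite.one_lt_card_iff_nontrivial.1 (by omega)
  have hA : ∀ y, T.Adj a y → y = w.getVert 1 := fun y hy =>
    eq_getVert_one_of_adj_of_length_eq_diam hT hw hd hy
  have hB : ∀ y, T.Adj b y → y = w.getVert (w.length - 1) := by
    intro y hy
    rw [eq_getVert_one_of_adj_of_length_eq_diam hT hw.reverse (by simpa using hd) hy,
      Walk.getVert_reverse]
  have hlen : 3 ≤ w.length := by
    by_contra hc
    rw [Walk.getVert_of_length_le w (by omega : w.length ≤ 2),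
      ← card_neighborFinset_eq_degree] at hdeg3
    have h1 : (T.neighborFinset b).card ≤ 1 := Finset.card_le_one.2 fun x hx y hy =>
      (hB x (by simpa using hx)).trans (hB y (by simpa using hy)).symm
    omega
  have hne : ∀ {i j : ℕ}, i ≤ w.length → j ≤ w.length → i ≠ j → w.getVert i ≠ w.getVert j :=
    fun hi hj hij h => hij (hinj hi hj h)
  have a01 : T.Adj a (w.getVert 1) := by
    simpa using w.adj_getVert_succ (i := 0) (by omega)
  have a12 : T.Adj (w.getVert 1) (w.getVert 2) := w.adj_getVert_succ (by omega)
  have a23 : T.Adj (w.getVert 2) (w.getVert 3) := w.adj_getVert_succ (by omega)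
  have h02 : a ≠ w.getVert 2 := by
    simpa using hne (i := 0) (j := 2) (by omega) (by omega) (by omega)
  have h03 : a ≠ w.getVert 3 := by
    simpa using hne (i := 0) (j := 3) (by omega) (by omega) (by omega)
  have h13 : w.getVert 1 ≠ w.getVert 3 := hne (by omega) (by omega) (by omega)
  have h₀ : ∀ u, T.Adj a u ↔ u = w.getVert 1 := fun u => ⟨hA u, fun h => h ▸ a01⟩
  have h₁ := adj_iff_of_degree_eq_two hdeg2 a01.symm a12 h02
  have h₂ := adj_iff_of_degree_eq_two hdeg3 a12.symm a23 h13
  have hlen' : 4 ≤ w.length := by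
    by_contra hc
    have h3 : w.length = 3 := by omega
    have hb : w.getVert 3 = b := w.getVert_of_length_le (by omega)
    refine hP4 (nonempty_iso_pathGraph_four hconn h₀ h₁ h₂ (fun u => ⟨fun h => ?_, ?_⟩)
      h02 h03 h13)
    · rw [hb] at h
      simpa [h3] using hB u h
    · rintro rfl
      exact a23.symm
  have h₃ : ¬ IsLeafVert T (w.getVert 3) := fun hl =>
    hne (i := 2) (j := 4) (by omega) (by omega) (by omega)
      (hl.unique a23.symm (w.adj_getVert_succ (by omega)))
  have key := isWeakLeaf_and_toidNumber_eq_of_pendant_path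
    (fun v => hconn.preconnected.exists_adj_of_nontrivial v)
    (not_adj_leaves_of_connected hconn hn) h₀ h₁ h₂ h02 h13 h₃ (by
      have h : (3 * toidNumber (subdivision T) + leafCount T + supportCount T : ℚ) =
          4 * Nat.card V := by rw [heq]; ring
      exact_mod_cast h)
  refine ⟨key.1, ?_⟩
  have h := congrArg (Nat.cast : ℕ → ℚ) key.2
  push_cast at h
  linarith
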